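/- arXiv:1610.02180 — 3 statements merged into one kernel-verified Lean document; each statement's English description precedes it below -/
import Mathlib

section
/- Let R be a reduced commutative ring and M a finitely generated R-module. Suppose f ∈ R has the following property: every g in the ideal generated by f such that the localization M[g^{-1}] is a free R[g^{-1}]-module satisfies g = 0. Then f = 0. In particular (taking f = 1): if every g ∈ R such that M[g^{-1}] is free over R[g^{-1}] satisfies g = 0, then R is the zero ring. -/
/-!
**Lemma 6.1 (constructive generic freeness).**  Let `R` be a reduced commutative ring
and `M` a finitely generated `R`-module.  If `f : R` is such that every `g` in the
ideal generated by `f` for which the localized module `M[g⁻¹]` is free over `R[g⁻¹]`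
satisfies `g = 0`, then `f = 0`.  In particular (taking `f = 1`), if every `g : R`
such that `M[g⁻¹]` is free over `R[g⁻¹]` satisfies `g = 0`, then `R` is the zero ring.
-/

universe u

/-- If every element of `M` is moved into the span of `s` by a power of `g`, and the coefficients
of every linear relation on `s` are killed by `g`, then `M[g⁻¹]` is free, with basis `s`. -/
theorem free_localizedModule_powers_of_finset {R : Type*} [CommRing R] {M : Type*}
    [AddCommGroup M] [Module R M] (g : R) (s : Finset M)
    (hspan : ∀ m : M, ∃ k : ℕ, g ^ k • m ∈ Submodule.span R (s : Set M))
    (hrel : ∀ a : M → R, ∑ x ∈ s, a x • x = 0 → ∀ x ∈ s, g * a x = 0) :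
    Module.Free (Localization.Away g) (LocalizedModule (Submonoid.powers g) M) := by
  let φ := LocalizedModule.mkLinearMap (Submonoid.powers g) M
  let v : s → LocalizedModule (Submonoid.powers g) M := fun x => φ x
  have hli : LinearIndependent (Localization.Away g) v := by
    rw [Fintype.linearIndependent_iff]
    intro c hc i
    obtain ⟨d, hd⟩ := IsLocalization.exist_integer_multiples_of_finite (Submonoid.powers g) c
    choose a ha using hd
    have hφ : φ (∑ x : s, a x • (x : M)) = 0 := by
      have h : ∑ x : s, (d : R) • c x • v x = 0 := by rw [← Finset.smul_sum, hc, smul_zero]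
      rw [map_sum, ← h]
      refine Finset.sum_congr rfl fun x _ => ?_
      rw [map_smul, ← smul_assoc, ← ha x, algebraMap_smul]
    obtain ⟨⟨_, k, rfl⟩, hk⟩ := (IsLocalizedModule.eq_zero_iff (Submonoid.powers g) φ).mp hφ
    have hk' : ∑ x : s, (g ^ k * a x) • (x : M) = 0 := by
      simpa [Submonoid.smul_def, Finset.smul_sum, mul_smul] using hk
    classical
    have hi := hrel (fun x => if h : x ∈ s then g ^ k * a ⟨x, h⟩ else 0)
      (by rw [← Finset.sum_coe_sort]; simpa using hk') i i.2
    have hi' : g ^ (k + 1) * a i = 0 := by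
      simpa [pow_succ', mul_assoc] using hi
    have hai : algebraMap R (Localization.Away g) (a i) = 0 :=
      (IsLocalization.map_eq_zero_iff (Submonoid.powers g) _ _).mpr ⟨⟨_, k + 1, rfl⟩, hi'⟩
    rw [ha i, Algebra.smul_def] at hai
    exact (IsLocalization.map_units (Localization.Away g) d).mul_right_eq_zero.mp hai
  refine Module.Free.of_basis (Module.Basis.mk hli ?_)
  rintro y -
  obtain ⟨⟨m, t⟩, rfl⟩ := IsLocalizedModule.mk'_surjective (Submonoid.powers g) φ y
  obtain ⟨k, hk⟩ := hspan m
  have hmem : φ (g ^ k • m) ∈ Submodule.span (Localization.Away g) (Set.range v) := by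
    refine Submodule.span_induction (fun x hx => Submodule.subset_span ⟨⟨x, hx⟩, rfl⟩)
      (by simp) (fun x y _ _ hx hy => by simpa using add_mem hx hy) (fun r x _ hx => ?_) hk
    rw [map_smul, ← algebraMap_smul (Localization.Away g)]
    exact Submodule.smul_mem _ _ hx
  have hu := IsLocalization.map_units (Localization.Away g)
    ((⟨g ^ k, k, rfl⟩ : Submonoid.powers g) * t)
  rw [← Submodule.smul_mem_iff_of_isUnit _ hu, algebraMap_smul]
  convert hmem using 1
  rw [Submonoid.coe_mul, mul_smul, ← Submonoid.smul_def t]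
  simp [φ]

/-- If `M[f⁻¹]` is spanned by a finite subset of `M` and `f ≠ 0`, then
`M[g⁻¹]` is free for some nonzero multiple `g` of `f`. -/
theorem exists_dvd_free_localizedModule_powers {R : Type*} [CommRing R] {M : Type*}
    [AddCommGroup M] [Module R M] (s : Finset M) (f : R) (hf : f ≠ 0)
    (hspan : ∀ m : M, ∃ k : ℕ, f ^ k • m ∈ Submodule.span R (s : Set M)) :
    ∃ g, f ∣ g ∧ g ≠ 0 ∧
      Module.Free (Localization.Away g) (LocalizedModule (Submonoid.powers g) M) := by
  classical
  induction s using Finset.strongInduction generalizing f with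
  | H s ih =>
    by_cases hrel : ∀ a : M → R, ∑ x ∈ s, a x • x = 0 → ∀ x ∈ s, f * a x = 0
    · exact ⟨f, dvd_rfl, hf, free_localizedModule_powers_of_finset f s hspan hrel⟩
    push Not at hrel
    obtain ⟨a, ha, x, hx, hax⟩ := hrel
    have hmem : a x • x ∈ Submodule.span R (s.erase x : Set M) := by
      rw [← Finset.add_sum_erase s _ hx] at ha
      rw [eq_neg_of_add_eq_zero_left ha]
      exact neg_mem (sum_mem fun y hy => Submodule.smul_mem _ _ (Submodule.subset_span hy))
    obtain ⟨g, hg, hg0, hfree⟩ := ih (s.erase x) (Finset.erase_ssubset hx) (f * a x) hax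
      fun m => by
        obtain ⟨k, hk⟩ := hspan m
        refine ⟨k + 1, ?_⟩
        rw [← Finset.insert_erase hx, Finset.coe_insert, Submodule.mem_span_insert] at hk
        obtain ⟨b, z, hz, hbz⟩ := hk
        have h : (f * a x) ^ (k + 1) • m = (f * a x ^ k) • (b • a x • x + a x • z) := by
          rw [smul_comm b, ← smul_add, ← hbz]
          simp only [smul_smul]
          congr 1
          ring
        rw [h]
        exact Submodule.smul_mem _ _
          (add_mem (Submodule.smul_mem _ _ hmem) (Submodule.smul_mem _ _ hz))
    exact ⟨g, (dvd_mul_right f (a x)).trans hg, hg0, hfree⟩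

theorem generic_freeness (R : Type u) [CommRing R] [IsReduced R]
    (M : Type u) [AddCommGroup M] [Module R M] [Module.Finite R M] :
    (∀ f : R,
      (∀ g ∈ Ideal.span ({f} : Set R),
        Module.Free (Localization.Away g)
          (LocalizedModule (Submonoid.powers g) M) → g = 0) →
      f = 0) ∧
    ((∀ g : R,
        Module.Free (Localization.Away g)
          (LocalizedModule (Submonoid.powers g) M) → g = 0) →
      Subsingleton R) := by
  have key : ∀ f : R,
      (∀ g ∈ Ideal.span ({f} : Set R),
        Module.Free (Localization.Away g)
          (LocalizedModule (Submonoid.powers g) M) → g = 0) →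
      f = 0 := by
    intro f hf
    by_contra hf0
    obtain ⟨s, hs⟩ := Module.Finite.fg_top (R := R) (M := M)
    obtain ⟨g, hfg, hg0, hfree⟩ := exists_dvd_free_localizedModule_powers s f hf0
      fun m => ⟨0, by simp [hs]⟩
    exact hg0 (hf g (Ideal.mem_span_singleton.mpr hfg) hfree)
  exact ⟨key, fun h => subsingleton_of_zero_eq_one (key 1 fun g _ => h g).symm⟩
end

section
/- Let R be a commutative ring and let M and N be finitely generated R-modules with the following property: for every commutative R-algebra S, if M ⊗_R S is a free S-module, then N ⊗_R S = 0. Then N = 0. -/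
/-!
**Lemma 6.3.**  Let `R` be a commutative ring and let `M` and `N` be finitely
generated `R`-modules such that for every commutative `R`-algebra `S`, if `S ⊗[R] M`
is a free `S`-module then `S ⊗[R] N = 0`.  Then `N = 0`.
-/

universe u

open TensorProduct

theorem vanishing_of_vanishing_on_free_locus
    (R : Type u) [CommRing R]
    (M N : Type u) [AddCommGroup M] [Module R M] [Module.Finite R M]
    [AddCommGroup N] [Module R N] [Module.Finite R N]
    (h : ∀ (S : Type u) [CommRing S] [Algebra R S],
      Module.Free S (S ⊗[R] M) → Subsingleton (S ⊗[R] N)) :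
    Subsingleton N := by
  rw [← Module.support_eq_empty_iff (R := R), Set.eq_empty_iff_forall_notMem]
  intro p hp
  rw [Module.mem_support_iff_nontrivial_residueField_tensorProduct] at hp
  exact not_subsingleton _ (h p.asIdeal.ResidueField inferInstance)
end

section
/- Let N denote the ℤ-module ℤ[1/2]/ℤ, i.e. the quotient of the localization of ℤ away from 2 by the image of the canonical map ℤ → ℤ[1/2] (equivalently, the colimit of the system ℤ/2ℤ → ℤ/4ℤ → ℤ/8ℤ → … with transition maps [x] ↦ [2x]). Then N ≠ 0, yet for every commutative ring S such that S/2S is a free S-module one has N ⊗_ℤ S = 0. Consequently, the hypothesis that N be finitely generated cannot be dropped from the statement: 'if M, N are R-modules with M finitely generated such that for every commutative R-algebra S with M ⊗_R S free over S one has N ⊗_R S = 0, then N = 0' (take R = ℤ and M = ℤ/2ℤ, noting M ⊗_ℤ S ≅ S/2S). -/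
/-!
**Example 6.4.**  Let `N := ℤ[1/2]/ℤ` (the quotient of the localization of `ℤ` away
from `2` by the image of `ℤ`).  Then `N ≠ 0`, but for every commutative ring `S` such
that `S/2S` is a free `S`-module one has `N ⊗[ℤ] S = 0`.  Consequently, in the
statement "if `M`, `N` are `R`-modules with `M` finitely generated such that for every
commutative `R`-algebra `S` with `M ⊗[R] S` free over `S` one has `N ⊗[R] S = 0`, then
`N = 0`" the hypothesis that `N` is finitely generated cannot be dropped (take `R = ℤ`
and `M = ℤ/2ℤ`, noting `M ⊗[ℤ] S ≅ S/2S`).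
-/

open TensorProduct

/-- `ℤ[1/2]/ℤ`, the quotient of the localization of `ℤ` away from `2` by the image of
the canonical map `ℤ → ℤ[1/2]`. -/
abbrev ZOneHalfModZ : Type :=
  Localization.Away (2 : ℤ) ⧸
    LinearMap.range ((algebraMap ℤ (Localization.Away (2 : ℤ))).toAddMonoidHom.toIntLinearMap)

theorem ZOneHalfModZ.exists_two_smul_eq (n : ZOneHalfModZ) :
    ∃ m : ZOneHalfModZ, n = (2 : ℤ) • m := by
  obtain ⟨x, rfl⟩ := Submodule.Quotient.mk_surjective _ n
  refine ⟨Submodule.Quotient.mk (IsLocalization.Away.invSelf (2 : ℤ) * x), ?_⟩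
  rw [← Submodule.Quotient.mk_smul, zsmul_eq_mul, ← mul_assoc]
  have h := IsLocalization.Away.mul_invSelf (S := Localization.Away (2 : ℤ)) (2 : ℤ)
  rw [eq_intCast] at h
  rw [h, one_mul]

theorem ZOneHalfModZ.exists_two_pow_smul_eq_zero (n : ZOneHalfModZ) :
    ∃ k : ℕ, ((2 : ℤ) ^ k) • n = 0 := by
  obtain ⟨x, rfl⟩ := Submodule.Quotient.mk_surjective _ n
  obtain ⟨k, a, h⟩ := IsLocalization.Away.surj (2 : ℤ) x
  refine ⟨k, ?_⟩
  rw [← Submodule.Quotient.mk_smul, Submodule.Quotient.mk_eq_zero]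
  refine ⟨a, ?_⟩
  change algebraMap ℤ (Localization.Away (2 : ℤ)) a = _
  rw [← h, zsmul_eq_mul, mul_comm, ← map_pow, eq_intCast]

theorem ZOneHalfModZ.nontrivial : Nontrivial ZOneHalfModZ := by
  refine Submodule.Quotient.nontrivial_iff.mpr fun htop => ?_
  have hmem : IsLocalization.Away.invSelf (S := Localization.Away (2 : ℤ)) (2 : ℤ) ∈
      LinearMap.range
        ((algebraMap ℤ (Localization.Away (2 : ℤ))).toAddMonoidHom.toIntLinearMap) :=
    htop ▸ Submodule.mem_top
  obtain ⟨a, ha⟩ := hmem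
  change algebraMap ℤ (Localization.Away (2 : ℤ)) a = _ at ha
  have h := IsLocalization.Away.mul_invSelf (S := Localization.Away (2 : ℤ)) (2 : ℤ)
  rw [← ha, ← map_mul, ← map_one (algebraMap ℤ (Localization.Away (2 : ℤ)))] at h
  have hinj : Function.Injective (algebraMap ℤ (Localization.Away (2 : ℤ))) :=
    IsLocalization.injective _ (powers_le_nonZeroDivisors_of_noZeroDivisors two_ne_zero)
  have := hinj h
  omega

theorem eq_zero_or_subsingleton_of_free {S Q : Type*} [CommRing S] [AddCommMonoid Q] [Module S Q]
    [Module.Free S Q] {a : S} (ha : ∀ q : Q, a • q = 0) : a = 0 ∨ Subsingleton Q := by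
  let b := Module.Free.chooseBasis S Q
  rcases isEmpty_or_nonempty (Module.Free.ChooseBasisIndex S Q) with _ | ⟨⟨i⟩⟩
  · exact Or.inr b.repr.toEquiv.subsingleton
  · left
    simpa using congrArg (fun q => b.repr q i) (ha (b i))

open scoped Pointwise in
theorem algebraMap_eq_zero_or_isUnit_of_free {R S : Type*} [CommRing R] [CommRing S] [Algebra R S]
    (a : R) (hfree : Module.Free S (S ⊗[R] (R ⧸ Ideal.span ({a} : Set R)))) :
    algebraMap R S a = 0 ∨ IsUnit (algebraMap R S a) := by
  have hkill (q : S ⊗[R] (R ⧸ Ideal.span ({a} : Set R))) : algebraMap R S a • q = 0 := by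
    rw [algebraMap_smul]
    induction q with
    | zero => exact smul_zero _
    | add x y hx hy => rw [smul_add, hx, hy, add_zero]
    | tmul s m =>
      have hm : a • m = 0 := by
        obtain ⟨x, rfl⟩ := Ideal.Quotient.mk_surjective m
        exact Ideal.Quotient.eq_zero_iff_mem.mpr
          (Ideal.mul_mem_right _ _ (Ideal.mem_span_singleton_self a))
      rw [← TensorProduct.tmul_smul, hm, TensorProduct.tmul_zero]
  refine (eq_zero_or_subsingleton_of_free hkill).imp_right fun hsub => ?_
  have hquot := @Equiv.subsingleton _ _ (TensorProduct.tensorQuotEquivQuotSMul S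
    (Ideal.span ({a} : Set R))).symm.toEquiv hsub
  rw [Submodule.Quotient.subsingleton_iff, Submodule.ideal_span_singleton_smul] at hquot
  obtain ⟨x, -, hx⟩ := hquot.ge (Submodule.mem_top (x := (1 : S)))
  change a • x = 1 at hx
  rw [Algebra.smul_def] at hx
  exact IsUnit.of_mul_eq_one x hx

theorem ZOneHalfModZ.subsingleton_tensorProduct {S : Type*} [CommRing S]
    (h : (2 : S) = 0 ∨ IsUnit (2 : S)) : Subsingleton (S ⊗[ℤ] ZOneHalfModZ) := by
  refine subsingleton_of_forall_eq 0 fun t => ?_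
  induction t with
  | zero => rfl
  | add x y hx hy => rw [hx, hy, add_zero]
  | tmul s n =>
    rcases h with h | h
    · obtain ⟨m, rfl⟩ := ZOneHalfModZ.exists_two_smul_eq n
      rw [← TensorProduct.smul_tmul, zsmul_eq_mul, Int.cast_ofNat, h, zero_mul,
        TensorProduct.zero_tmul]
    · obtain ⟨k, hk⟩ := ZOneHalfModZ.exists_two_pow_smul_eq_zero n
      obtain ⟨u, hu⟩ := h.pow k
      have hs : s = ((2 : ℤ) ^ k) • ((↑u⁻¹ : S) * s) := by
        rw [zsmul_eq_mul, Int.cast_pow, Int.cast_ofNat, ← hu, Units.mul_inv_cancel_left]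
      rw [hs, TensorProduct.smul_tmul, hk, TensorProduct.tmul_zero]

theorem counterexample_finiteness_needed :
    Nontrivial ZOneHalfModZ ∧
    (∀ (S : Type) [CommRing S],
      Module.Free S (S ⧸ (Ideal.span ({2} : Set S))) →
        Subsingleton (S ⊗[ℤ] ZOneHalfModZ)) ∧
    ¬ (∀ (R M N : Type) [CommRing R]
        [AddCommGroup M] [Module R M] [Module.Finite R M]
        [AddCommGroup N] [Module R N],
        (∀ (S : Type) [CommRing S] [Algebra R S],
          Module.Free S (S ⊗[R] M) → Subsingleton (S ⊗[R] N)) →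
        Subsingleton N) := by
  refine ⟨ZOneHalfModZ.nontrivial, fun S _ hfree => ?_, fun H => ?_⟩
  · have hkill (q : S ⧸ Ideal.span ({2} : Set S)) : (2 : S) • q = 0 := by
      obtain ⟨x, rfl⟩ := Ideal.Quotient.mk_surjective q
      refine Ideal.Quotient.eq_zero_iff_mem.mpr ?_
      exact Ideal.mul_mem_right _ _ (Ideal.mem_span_singleton_self 2)
    refine ZOneHalfModZ.subsingleton_tensorProduct
      ((eq_zero_or_subsingleton_of_free hkill).imp_right fun hsub => ?_)
    rwa [Ideal.Quotient.subsingleton_iff, Ideal.span_singleton_eq_top] at hsub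
  · have : Module.Finite ℤ (ℤ ⧸ Ideal.span ({2} : Set ℤ)) :=
      Module.Finite.of_surjective (Submodule.mkQ (Ideal.span ({2} : Set ℤ)))
        (Submodule.mkQ_surjective _)
    refine not_subsingleton_iff_nontrivial.mpr ZOneHalfModZ.nontrivial
      (H ℤ (ℤ ⧸ Ideal.span ({2} : Set ℤ)) ZOneHalfModZ fun S _ instAlg hfree => ?_)
    obtain rfl : instAlg = Ring.toIntAlgebra S := Algebra.algebra_ext _ _ fun _ => by simp
    have := algebraMap_eq_zero_or_isUnit_of_free (R := ℤ) (S := S) 2 hfree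
    rw [map_ofNat] at this
    exact ZOneHalfModZ.subsingleton_tensorProduct this
end
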